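/- Let c be a nonzero cubic form in n variables with real coefficients and let σ ∈ {0,…,n−1}. Suppose there exist linear subspaces X, Y ⊆ ℝ^n with dim X + dim Y = n + σ + 1 such that Yᵀ·H_c(X)·Y′ = 0 for all X ∈ X and all Y, Y′ ∈ Y. Then the singular locus of the projective hypersurface V(c) ⊆ ℙ^{n−1} cut out by c = 0 has dimension at least σ. -/

import Mathlib

open MvPolynomial Matrix

/-- `‖c‖ = (1/6)·max_{i,j,k} |∂³c/∂x_i∂x_j∂x_k|` for a cubic form `c`. -/
noncomputable def cubicNorm {n : ℕ} (c : MvPolynomial (Fin n) ℝ) : ℝ :=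
  (1 / 6) * ⨆ i : Fin n, ⨆ j : Fin n, ⨆ k : Fin n,
    |MvPolynomial.eval (0 : Fin n → ℝ) (pderiv i (pderiv j (pderiv k c)))|

/-- The normalised Hessian matrix `H_c(x)` with entries `(1/‖c‖)·∂²c(x)/∂x_i∂x_j`. -/
noncomputable def hessMat {n : ℕ} (c : MvPolynomial (Fin n) ℝ) (x : Fin n → ℝ) :
    Matrix (Fin n) (Fin n) ℝ :=
  Matrix.of fun i j => (cubicNorm c)⁻¹ * MvPolynomial.eval x (pderiv i (pderiv j c))

/-- The ideal generated by the first `i` variables, as a kernel. -/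
noncomputable def coordMap (b i : ℕ) :
    MvPolynomial (Fin b) ℂ →ₐ[ℂ] MvPolynomial (Fin b) ℂ :=
  aeval fun j : Fin b => if (j : ℕ) < i then 0 else X j

lemma coordMap_height (b i : ℕ) (hi : i ≤ b) :
    (i : ℕ∞) ≤ (RingHom.ker (coordMap b i)).height := by
  induction i with
  | zero => simp
  | succ i ih =>
    have h1 := ih (by omega)
    have hp : (RingHom.ker (coordMap b i)).IsPrime := RingHom.ker_isPrime _
    have hp' : (RingHom.ker (coordMap b (i+1))).IsPrime := RingHom.ker_isPrime _
    have hcomp : (coordMap b (i+1)).comp (coordMap b i) = coordMap b (i+1) := by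
      apply MvPolynomial.algHom_ext
      intro j
      by_cases hj : (j : ℕ) < i
      · have : (j : ℕ) < i + 1 := by omega
        simp only [coordMap, AlgHom.comp_apply, aeval_X, hj, this, if_true, map_zero]
      · simp [coordMap, hj]
    have hlt : RingHom.ker (coordMap b i) < RingHom.ker (coordMap b (i+1)) := by
      refine lt_of_le_of_ne ?_ ?_
      · intro p hpm
        rw [RingHom.mem_ker] at hpm ⊢
        rw [← hcomp, AlgHom.comp_apply, hpm, map_zero]
      · intro h
        have hm : (X (⟨i, by omega⟩ : Fin b) : MvPolynomial (Fin b) ℂ) ∈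
            RingHom.ker (coordMap b (i+1)) := by
          rw [RingHom.mem_ker]; simp [coordMap]
        rw [← h, RingHom.mem_ker] at hm
        simp [coordMap] at hm
    have h2 := Ideal.height_add_one_le_of_lt_of_isPrime hlt
    push_cast
    exact le_trans (by gcongr) h2

lemma pderiv_comm' {n : ℕ} (i j : Fin n) (c : MvPolynomial (Fin n) ℝ) :
    pderiv i (pderiv j c) = pderiv j (pderiv i c) := by
  classical
  ext m
  simp only [coeff_pderiv, Finsupp.add_apply]
  by_cases h : i = j
  · subst h; rfl
  · rw [Finsupp.single_eq_of_ne h, Finsupp.single_eq_of_ne (Ne.symm h), add_right_comm]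
    push_cast
    ring

lemma euler_eval {n d : ℕ} {p : MvPolynomial (Fin n) ℝ} (h : p.IsHomogeneous d) (x : Fin n → ℝ) :
    ∑ i, x i * eval x (pderiv i p) = d * eval x p := by
  have := congrArg (eval x) h.sum_X_mul_pderiv
  simpa using this

lemma eval_deg_zero {n : ℕ} {p : MvPolynomial (Fin n) ℝ} (h : p.IsHomogeneous 0) (x : Fin n → ℝ) :
    eval x p = eval 0 p := by
  rw [← totalDegree_zero_iff_isHomogeneous, totalDegree_eq_zero_iff_eq_C] at h
  rw [h]; simp

lemma hom3 {n : ℕ} {c : MvPolynomial (Fin n) ℝ} (hdeg : c.IsHomogeneous 3) (i j k : Fin n) :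
    (pderiv i (pderiv j (pderiv k c))).IsHomogeneous 0 := by
  simpa using hdeg.pderiv.pderiv.pderiv (i := i)

lemma hess_eval {n : ℕ} {c : MvPolynomial (Fin n) ℝ} (hdeg : c.IsHomogeneous 3) (j k : Fin n)
    (x : Fin n → ℝ) : eval x (pderiv j (pderiv k c)) =
      ∑ i, x i * eval 0 (pderiv i (pderiv j (pderiv k c))) := by
  have h : (pderiv j (pderiv k c)).IsHomogeneous 1 := by simpa using hdeg.pderiv.pderiv (i := j)
  have := euler_eval h x
  rw [Nat.cast_one, one_mul] at this
  rw [← this]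
  exact Finset.sum_congr rfl fun i _ => by rw [eval_deg_zero (hom3 hdeg i j k) x]

lemma grad_eval {n : ℕ} {c : MvPolynomial (Fin n) ℝ} (hdeg : c.IsHomogeneous 3) (k : Fin n)
    (x : Fin n → ℝ) : 2 * eval x (pderiv k c) =
      ∑ j, x j * ∑ i, x i * eval 0 (pderiv i (pderiv j (pderiv k c))) := by
  have h : (pderiv k c).IsHomogeneous 2 := by simpa using hdeg.pderiv (i := k)
  have := euler_eval h x
  rw [Nat.cast_ofNat] at this
  rw [← this]
  exact Finset.sum_congr rfl fun i _ => by rw [hess_eval hdeg]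

lemma cubicNorm_ne_zero {n : ℕ} {c : MvPolynomial (Fin n) ℝ} (hc : c ≠ 0)
    (hdeg : c.IsHomogeneous 3) : cubicNorm c ≠ 0 := by
  intro h0
  have hsup : (⨆ i : Fin n, ⨆ j : Fin n, ⨆ k : Fin n,
    |MvPolynomial.eval (0 : Fin n → ℝ) (pderiv i (pderiv j (pderiv k c)))|) = 0 := by
    unfold cubicNorm at h0
    linarith
  have hz : ∀ i j k : Fin n, eval (0 : Fin n → ℝ) (pderiv i (pderiv j (pderiv k c))) = 0 := by
    intro i j k
    have h1 := le_ciSup (f := fun i : Fin n => ⨆ j : Fin n, ⨆ k : Fin n,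
      |eval (0 : Fin n → ℝ) (pderiv i (pderiv j (pderiv k c)))|) (Set.finite_range _).bddAbove i
    have h2 := le_ciSup (f := fun j : Fin n => ⨆ k : Fin n,
      |eval (0 : Fin n → ℝ) (pderiv i (pderiv j (pderiv k c)))|) (Set.finite_range _).bddAbove j
    have h3 := le_ciSup (f := fun k : Fin n =>
      |eval (0 : Fin n → ℝ) (pderiv i (pderiv j (pderiv k c)))|) (Set.finite_range _).bddAbove k
    rw [hsup] at h1
    exact abs_nonpos_iff.mp (h3.trans (h2.trans h1))
  apply hc
  apply MvPolynomial.funext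
  intro x
  have h3 := euler_eval hdeg x
  have hg : ∀ k, eval x (pderiv k c) = 0 := by
    intro k
    have := grad_eval hdeg k x
    simp only [hz, mul_zero, Finset.sum_const_zero] at this
    linarith
  simp only [hg, mul_zero, Finset.sum_const_zero] at h3
  push_cast at h3
  rw [map_zero]
  linarith

lemma grad_vanish {n : ℕ} {c : MvPolynomial (Fin n) ℝ} (hc : c ≠ 0)
    (hdeg : c.IsHomogeneous 3) (x y : Fin n → ℝ)
    (h : y ⬝ᵥ (hessMat c x).mulVec y = 0) : ∑ k, x k * eval y (pderiv k c) = 0 := by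
  have hN := cubicNorm_ne_zero hc hdeg
  have key : y ⬝ᵥ (hessMat c x).mulVec y =
      (cubicNorm c)⁻¹ * (2 * ∑ k, x k * eval y (pderiv k c)) := by
    have e1 : 2 * ∑ k, x k * eval y (pderiv k c) = ∑ k, ∑ j, ∑ i,
        x k * (y j * (y i * eval 0 (pderiv i (pderiv j (pderiv k c))))) := by
      rw [Finset.mul_sum]
      refine Finset.sum_congr rfl fun k _ => ?_
      rw [mul_left_comm, grad_eval hdeg]
      simp only [Finset.mul_sum]
    have e2 : y ⬝ᵥ (hessMat c x).mulVec y = ∑ i, ∑ j, ∑ k, (cubicNorm c)⁻¹ *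
        (x k * (y j * (y i * eval 0 (pderiv i (pderiv j (pderiv k c)))))) := by
      simp only [dotProduct, mulVec, hessMat, Matrix.of_apply, hess_eval hdeg, Finset.mul_sum,
        Finset.sum_mul]
      refine Finset.sum_congr rfl fun i _ => Finset.sum_congr rfl fun j _ =>
        Finset.sum_congr rfl fun k _ => ?_
      rw [pderiv_comm' k i, pderiv_comm' k j]
      ring
    rw [e1, e2, Finset.sum_comm]
    simp only [Finset.mul_sum]
    rw [Finset.sum_comm' (t' := Finset.univ) (s' := fun _ => Finset.univ) (by simp)]
    rw [Finset.sum_congr rfl fun i _ => Finset.sum_comm]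
    rw [Finset.sum_comm]
    refine Finset.sum_congr rfl fun k _ => ?_
    rw [Finset.sum_comm]
  rw [h] at key
  have := mul_eq_zero.mp key.symm
  rcases this with h | h
  · exact absurd h (inv_ne_zero hN)
  · linarith

/-- If there are subspaces `X, Y ⊆ ℝ^n` with
`dim X + dim Y = n + σ + 1` on which the trilinear form `Yᵀ H_c(X) Y'` vanishes
identically, then the singular locus of the projective hypersurface `V(c)` over ℂ
(the projective variety cut out by the vanishing of the gradient of `c`) has
dimension at least `σ`; equivalently, the affine cone over `Sing V(c)` — whose
coordinate ring is the quotient by the ideal generated by the partial derivatives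
of `c` — has Krull dimension at least `σ + 1`. -/
theorem statement10 (n : ℕ) (c : MvPolynomial (Fin n) ℝ) (hc : c ≠ 0)
    (hdeg : c.IsHomogeneous 3) (σ : ℕ) (hσ : σ ≤ n - 1)
    (X Y : Submodule ℝ (Fin n → ℝ))
    (hdim : Module.finrank ℝ X + Module.finrank ℝ Y = n + σ + 1)
    (hvanish : ∀ x ∈ X, ∀ y ∈ Y, ∀ y' ∈ Y, y ⬝ᵥ (hessMat c x).mulVec y' = 0) :
    ((σ + 1 : ℕ) : WithBot ℕ∞) ≤
      ringKrullDim (MvPolynomial (Fin n) ℂ ⧸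
        Ideal.span (Set.range fun i : Fin n =>
          MvPolynomial.map (algebraMap ℝ ℂ) (pderiv i c))) := by
  classical
  set b := Module.finrank ℝ Y with hb
  let B : Module.Basis (Fin b) ℝ Y := Module.finBasis ℝ Y
  let φr : MvPolynomial (Fin n) ℝ →ₐ[ℝ] MvPolynomial (Fin b) ℝ :=
    aeval fun i => ∑ j, C ((B j : Fin n → ℝ) i) * MvPolynomial.X j
  have hφr : ∀ (t : Fin b → ℝ) (p : MvPolynomial (Fin n) ℝ),
      eval t (φr p) = eval ((∑ j, t j • B j : Y) : Fin n → ℝ) p := by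
    intro t p
    have : (aeval t).comp φr = aeval ((∑ j, t j • B j : Y) : Fin n → ℝ) := by
      apply MvPolynomial.algHom_ext
      intro i
      simp [φr, mul_comm]
    have h := DFunLike.congr_fun this p
    simpa [MvPolynomial.aeval_eq_eval] using h
  let L : (Fin n → ℝ) →ₗ[ℝ] MvPolynomial (Fin b) ℝ :=
    Fintype.linearCombination ℝ (fun k => φr (pderiv k c))
  have hL : ∀ x t, eval t (L x) = ∑ k, x k * eval ((∑ j, t j • B j : Y) : Fin n → ℝ)
      (pderiv k c) := by
    intro x t
    simp [L, Fintype.linearCombination_apply, hφr, smul_eval]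
  have hker : X ≤ LinearMap.ker L := by
    intro x hx
    rw [LinearMap.mem_ker]
    apply MvPolynomial.funext
    intro t
    rw [hL, map_zero]
    exact grad_vanish hc hdeg _ _ (hvanish x hx _ (Submodule.coe_mem _) _ (Submodule.coe_mem _))
  have hrank := L.finrank_range_add_finrank_ker
  have hle := Submodule.finrank_mono hker
  rw [Module.finrank_fin_fun] at hrank
  set r := Module.finrank ℝ (LinearMap.range L) with hr
  let D : Module.Basis (Fin r) ℝ (LinearMap.range L) := Module.finBasis ℝ _
  let m : MvPolynomial (Fin b) ℝ →+* MvPolynomial (Fin b) ℂ := MvPolynomial.map (algebraMap ℝ ℂ)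
  let S : Set (MvPolynomial (Fin b) ℂ) := Set.range fun l => m (D l : MvPolynomial (Fin b) ℝ)
  have hScard : S.encard ≤ r := by
    have := Set.encard_image_le (fun l => m (D l : MvPolynomial (Fin b) ℝ)) Set.univ
    rw [Set.image_univ] at this
    simpa using this
  let φc : MvPolynomial (Fin n) ℂ →ₐ[ℂ] MvPolynomial (Fin b) ℂ :=
    aeval fun i => ∑ j, C (algebraMap ℝ ℂ ((B j : Fin n → ℝ) i)) * MvPolynomial.X j
  have hcomm : ∀ p, φc (MvPolynomial.map (algebraMap ℝ ℂ) p) = m (φr p) := by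
    intro p
    have : (φc : MvPolynomial (Fin n) ℂ →+* MvPolynomial (Fin b) ℂ).comp (MvPolynomial.map (algebraMap ℝ ℂ)) =
        m.comp (φr : MvPolynomial (Fin n) ℝ →+* MvPolynomial (Fin b) ℝ) := by
      apply MvPolynomial.ringHom_ext
      · intro a
        simp [φc, m, φr]
      · intro i
        simp [φc, m, φr]
    exact DFunLike.congr_fun this p
  -- surjectivity
  let ι : (Fin b → ℝ) →ₗ[ℝ] (Fin n → ℝ) := Y.subtype ∘ₗ (B.equivFun.symm : (Fin b → ℝ) →ₗ[ℝ] Y)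
  have hι : LinearMap.ker ι = ⊥ := by
    rw [LinearMap.ker_eq_bot]
    exact Y.injective_subtype.comp B.equivFun.symm.injective
  obtain ⟨g, hg⟩ := LinearMap.exists_leftInverse_of_injective ι hι
  have hgB : ∀ j k : Fin b, ∑ i, (B k : Fin n → ℝ) i * g (Pi.single i 1) j =
      if j = k then 1 else 0 := by
    intro j k
    have h1 : ι (Pi.single k 1) = (B k : Fin n → ℝ) := by
      simp [ι, Module.Basis.equivFun_symm_apply, Pi.single_apply]
    have h2 := DFunLike.congr_fun hg (Pi.single k 1)
    rw [LinearMap.comp_apply, h1, LinearMap.pi_apply_eq_sum_univ g] at h2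
    have h3 := congrFun h2 j
    simp only [Finset.sum_apply, Pi.smul_apply, smul_eq_mul, LinearMap.id_apply,
      Pi.single_apply] at h3
    rw [← h3]
    refine Finset.sum_congr rfl fun i _ => ?_
    congr 2
    refine congrFun (congrArg g ?_) j
    ext l
    simp [Pi.single_apply, eq_comm]
  have hsurj : Function.Surjective φc := by
    let ψ : MvPolynomial (Fin b) ℂ →ₐ[ℂ] MvPolynomial (Fin n) ℂ :=
      aeval fun j => ∑ i, C (algebraMap ℝ ℂ (g (Pi.single i 1) j)) * MvPolynomial.X i
    have hid : φc.comp ψ = AlgHom.id ℂ _ := by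
      apply MvPolynomial.algHom_ext
      intro j
      have e : φc (ψ (MvPolynomial.X j)) = ∑ k, C (algebraMap ℝ ℂ
          (∑ i, (B k : Fin n → ℝ) i * g (Pi.single i 1) j)) * MvPolynomial.X k := by
        simp only [ψ, aeval_X, map_sum, map_mul, φc, algHom_C, Finset.mul_sum, Finset.sum_mul,
          MvPolynomial.algebraMap_eq]
        rw [Finset.sum_comm]
        refine Finset.sum_congr rfl fun i _ => Finset.sum_congr rfl fun k _ => ?_
        ring
      rw [AlgHom.comp_apply, e]
      simp [hgB]
    intro q
    exact ⟨ψ q, DFunLike.congr_fun hid q⟩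
  have hIle : Ideal.span (Set.range fun i : Fin n =>
      MvPolynomial.map (algebraMap ℝ ℂ) (pderiv i c)) ≤
      (Ideal.span S).comap (φc : MvPolynomial (Fin n) ℂ →+* MvPolynomial (Fin b) ℂ) := by
    rw [Ideal.span_le]
    rintro _ ⟨k, rfl⟩
    change φc _ ∈ Ideal.span S
    rw [hcomm]
    have hmem : φr (pderiv k c) ∈ LinearMap.range L :=
      ⟨Pi.single k 1, by simp [L, Fintype.linearCombination_apply_single]⟩
    have hsum := congrArg (Subtype.val) (D.sum_repr ⟨_, hmem⟩)
    rw [← show _ = φr (pderiv k c) from hsum]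
    simp only [Submodule.coe_sum, Submodule.coe_smul, map_sum, MvPolynomial.smul_eq_C_mul, map_mul]
    exact Ideal.sum_mem _ fun l _ => Ideal.mul_mem_left _ _ (Ideal.subset_span ⟨l, rfl⟩)
  have hdimle := ringKrullDim_le_of_surjective
    (Ideal.quotientMap (Ideal.span S) (φc : MvPolynomial (Fin n) ℂ →+* MvPolynomial (Fin b) ℂ) hIle)
    (Ideal.quotientMap_surjective hsurj)
  refine le_trans ?_ hdimle
  have hp : (RingHom.ker (coordMap b b)).IsPrime := RingHom.ker_isPrime _
  have hSp : S ⊆ RingHom.ker (coordMap b b) := by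
    rintro _ ⟨l, rfl⟩
    obtain ⟨x, hx⟩ := (D l).2
    rw [SetLike.mem_coe, RingHom.mem_ker]
    have h0 : coordMap b b = aeval (fun _ => 0) := by
      simp [coordMap]
    have hg0 : ∀ k, eval (0 : Fin n → ℝ) (pderiv k c) = 0 := by
      intro k
      have := grad_eval hdeg k 0
      simpa using this
    have h1 : constantCoeff (D l : MvPolynomial (Fin b) ℝ) = 0 := by
      rw [← hx, ← MvPolynomial.eval_zero, hL]
      simp only [Pi.zero_apply, zero_smul, Finset.sum_const_zero, ZeroMemClass.coe_zero, hg0, mul_zero]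
    rw [h0]
    rw [MvPolynomial.aeval_zero', MvPolynomial.constantCoeff_map, h1, map_zero, map_zero]
  have hfin := Ideal.height_le_ringKrullDim_quotient_add_encard S hSp
  have hh := coordMap_height b b le_rfl
  have hbr : ((b : ℕ) : WithBot ℕ∞) ≤ ringKrullDim (MvPolynomial (Fin b) ℂ ⧸ Ideal.span S) +
      ((r : ℕ) : WithBot ℕ∞) := by
    refine le_trans ?_ (hfin.trans ?_)
    · exact_mod_cast hh
    · gcongr
      exact_mod_cast hScard
  have hnum : σ + 1 + r ≤ b := by omega
  have h2 : ((σ + 1 : ℕ) : WithBot ℕ∞) + ((r : ℕ) : WithBot ℕ∞) ≤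
      ringKrullDim (MvPolynomial (Fin b) ℂ ⧸ Ideal.span S) + ((r : ℕ) : WithBot ℕ∞) := by
    refine le_trans ?_ hbr
    exact_mod_cast hnum
  generalize ringKrullDim (MvPolynomial (Fin b) ℂ ⧸ Ideal.span S) = d at h2
  induction d using WithBot.recBotCoe with
  | bot =>
    rw [WithBot.bot_add] at h2
    exact absurd h2 (by rw [le_bot_iff]; exact_mod_cast WithBot.coe_ne_bot)
  | coe d =>
    have h3 : ((σ + 1 : ℕ) : ℕ∞) + ((r : ℕ) : ℕ∞) ≤ d + ((r : ℕ) : ℕ∞) := by exact_mod_cast h2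
    have h4 := (ENat.add_le_add_iff_right (ENat.natCast_ne_top r)).mp h3
    exact_mod_cast h4
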